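/- arXiv:1802.09859 — 2 statements merged into one kernel-verified Lean document; each statement's English description precedes it below -/
import Mathlib

section
/- Let M be a matroid on an n-element set E with rank r(M), and let Q'_M be the polynomial associated to a Q'-datum for M. Then for all rational numbers x, y with x ≠ 0, y ≠ 0 and xy − x − y ≠ 0: (−y)^{r(M)}·(−x)^{n−r(M)}·T_M(x,y) = −xy·(xy−x−y)^{n−1} · Q'_M(−x/(xy−x−y), −y/(xy−x−y)). (This is the paper's inversion formula T_M(x,y) = −(xy−x−y)^{n−1}/((−y)^{r(M)−1}(−x)^{n−r(M)−1}) · Q'_M(−x/(xy−x−y), −y/(xy−x−y)), multiplied through by xy to clear the exponents r(M)−1 and n−r(M)−1.) -/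
open scoped Pointwise
open Finset

noncomputable section

/-- The standard simplex `Δ = conv{e_i : i ∈ E}` in `ℝ^E`. -/
def stdSimplexSet (α : Type*) [Fintype α] [DecidableEq α] : Set (α → ℝ) :=
  convexHull ℝ {x : α → ℝ | ∃ i : α, x = Pi.single i (1 : ℝ)}

/-- The number of lattice points (points of `ℤ^E`) in a subset of `ℝ^E`. -/
def latticeCount {α : Type*} (P : Set (α → ℝ)) : ℕ :=
  Set.ncard {q : α → ℤ | (fun i => (q i : ℝ)) ∈ P}

/-- `Qcount P t u` is the number of lattice points of `P + uΔ + t∇`. -/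
def Qcount {α : Type*} [Fintype α] [DecidableEq α] (P : Set (α → ℝ)) (t u : ℕ) : ℕ :=
  latticeCount (P + (u : ℝ) • stdSimplexSet α + (t : ℝ) • (-stdSimplexSet α))

/-- A polymatroid on a finite ground set, given by its rank function. -/
structure PolyMatroid (α : Type*) [Fintype α] [DecidableEq α] where
  rk : Finset α → ℕ
  rk_empty : rk ∅ = 0
  rk_mono : ∀ ⦃S T : Finset α⦄, S ⊆ T → rk S ≤ rk T
  rk_submod : ∀ S T : Finset α, rk (S ∪ T) + rk (S ∩ T) ≤ rk S + rk T

variable {α : Type*} [Fintype α] [DecidableEq α]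

/-- A basis of a matroid (an independent spanning set). -/
def PolyMatroid.IsBasis (M : PolyMatroid α) (B : Finset α) : Prop :=
  M.rk B = B.card ∧ M.rk B = M.rk Finset.univ

/-- The indicator vector of a finite set. -/
def indicatorVec {α : Type*} [DecidableEq α] (B : Finset α) : α → ℝ :=
  fun i => if i ∈ B then 1 else 0

/-- The base polytope of a matroid: the convex hull of indicator vectors of bases. -/
def matroidPolytope (M : PolyMatroid α) : Set (α → ℝ) :=
  convexHull ℝ {x : α → ℝ | ∃ B : Finset α, M.IsBasis B ∧ x = indicatorVec B}

/-- The base polytope of a polymatroid, by its inequality description. -/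
def PolyMatroid.polytope (M : PolyMatroid α) : Set (α → ℝ) :=
  {x | (∑ i, x i) = (M.rk Finset.univ : ℝ) ∧
    ∀ S : Finset α, (∑ i ∈ S, x i) ≤ (M.rk S : ℝ)}

/-- `c : ℕ × ℕ → ℤ` is a `Q'`-datum for the counting function `Q` if it is finitely
supported and interpolates `Q` in the binomial basis. -/
def IsQdatumFun (Q : ℕ → ℕ → ℕ) (c : ℕ × ℕ → ℤ) : Prop :=
  (Function.support c).Finite ∧
    ∀ t u : ℕ, (Q t u : ℤ) = ∑ᶠ p : ℕ × ℕ, c p * (t.choose p.1 : ℤ) * (u.choose p.2 : ℤ)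

/-- A `Q'`-datum for the lattice-point counting function of the polytope `P`. -/
def IsQdatum (P : Set (α → ℝ)) (c : ℕ × ℕ → ℤ) : Prop :=
  IsQdatumFun (Qcount P) c

/-- The polynomial `Q'` associated to a `Q'`-datum, as a function on `ℚ × ℚ`. -/
def Qprime (c : ℕ × ℕ → ℤ) (x y : ℚ) : ℚ :=
  ∑ᶠ p : ℕ × ℕ, (c p : ℚ) * (x - 1) ^ p.1 * (y - 1) ^ p.2

/-- The polynomial `Q'` associated to a `Q'`-datum, as a polynomial in two variables. -/
def QprimePoly (c : ℕ × ℕ → ℤ) : MvPolynomial (Fin 2) ℤ :=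
  ∑ᶠ p : ℕ × ℕ,
    MvPolynomial.C (c p) * (MvPolynomial.X 0 - 1) ^ p.1 * (MvPolynomial.X 1 - 1) ^ p.2

/-- The Tutte polynomial of a matroid, as a function on `ℚ × ℚ`. -/
def TuttePoly (M : PolyMatroid α) (x y : ℚ) : ℚ :=
  ∑ S : Finset α,
    (x - 1) ^ (M.rk Finset.univ - M.rk S) * (y - 1) ^ (S.card - M.rk S)



namespace PolyMatroid

lemma rk_union_le_add_card (M : PolyMatroid α) (hmat : ∀ i : α, M.rk {i} ≤ 1)
    (S T : Finset α) : M.rk (S ∪ T) ≤ M.rk S + T.card := by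
  induction T using Finset.induction_on with
  | empty => simp
  | insert i T hi ih =>
    have h := M.rk_submod (S ∪ T) {i}
    have he : S ∪ insert i T = (S ∪ T) ∪ {i} := by
      ext; simp
    rw [he, card_insert_of_notMem hi]
    have := hmat i
    omega

lemma rk_le_card (M : PolyMatroid α) (hmat : ∀ i : α, M.rk {i} ≤ 1) (S : Finset α) :
    M.rk S ≤ S.card := by
  simpa [M.rk_empty] using M.rk_union_le_add_card hmat ∅ S

lemma rk_eq_card_of_subset (M : PolyMatroid α) (hmat : ∀ i : α, M.rk {i} ≤ 1)
    {A B : Finset α} (hAB : A ⊆ B) (hB : M.rk B = B.card) : M.rk A = A.card := by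
  have h1 := M.rk_union_le_add_card hmat A (B \ A)
  rw [union_sdiff_of_subset hAB] at h1
  have h2 := card_sdiff_add_card_eq_card hAB
  have h3 := M.rk_le_card hmat A
  omega

lemma rk_union_eq_of_forall_insert (M : PolyMatroid α) (J : Finset α) (U : Finset α)
    (h : ∀ e ∈ U, M.rk (insert e J) = M.rk J) : M.rk (J ∪ U) = M.rk J := by
  induction U using Finset.induction_on with
  | empty => simp
  | insert i U hi ih =>
    have h1 := ih fun e he => h e (mem_insert_of_mem he)
    have h2 := h i (mem_insert_self i U)
    have h3 := M.rk_submod (J ∪ U) (insert i J)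
    have h4 : J ∪ insert i U = (J ∪ U) ∪ insert i J := by
      ext; simp; tauto
    have h5 : M.rk J ≤ M.rk ((J ∪ U) ∩ insert i J) :=
      M.rk_mono (subset_inter subset_union_left (subset_insert _ _))
    have h6 : M.rk J ≤ M.rk (J ∪ insert i U) := M.rk_mono subset_union_left
    rw [← h4] at h3
    omega

lemma exists_indep_extension (M : PolyMatroid α) (hmat : ∀ i : α, M.rk {i} ≤ 1)
    {I T : Finset α} (hIT : I ⊆ T) (hI : M.rk I = I.card) :
    ∃ J, I ⊆ J ∧ J ⊆ T ∧ M.rk J = J.card ∧ M.rk J = M.rk T := by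
  obtain ⟨J, hJ, hmax⟩ := exists_max_image
    (univ.filter fun J : Finset α => I ⊆ J ∧ J ⊆ T ∧ M.rk J = J.card) Finset.card
    ⟨I, by simp [hIT, hI]⟩
  simp only [mem_filter, mem_univ, true_and] at hJ hmax
  obtain ⟨hIJ, hJT, hJc⟩ := hJ
  refine ⟨J, hIJ, hJT, hJc, ?_⟩
  have key := M.rk_union_eq_of_forall_insert J T fun e he => by
    by_cases heJ : e ∈ J
    · rw [insert_eq_of_mem heJ]
    have h1 := M.rk_mono (subset_insert e J)
    have h2 := M.rk_le_card hmat (insert e J)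
    have h3 := hmax (insert e J)
    rw [card_insert_of_notMem heJ] at h2 h3
    by_contra hne
    have := h3 ⟨hIJ.trans (subset_insert _ _), insert_subset he hJT, by omega⟩
    omega
  rw [← key, union_eq_right.mpr hJT]

end PolyMatroid

/-- The set of coordinates at which an integer vector is positive. -/
def posSupport (q : α → ℤ) : Finset α := univ.filter fun i => 0 < q i

/-- The distance by which an integer vector exceeds the rank constraints of a matroid. -/
def PolyMatroid.excess (M : PolyMatroid α) (q : α → ℤ) : ℤ :=
  ∑ i ∈ posSupport q, q i - M.rk (posSupport q)

lemma sum_eq_one_and_nonneg_of_mem_stdSimplexSet {x : α → ℝ} (hx : x ∈ stdSimplexSet α) :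
    ∑ i, x i = 1 ∧ ∀ i, 0 ≤ x i := by
  have h : stdSimplexSet α ⊆ stdSimplex ℝ α := by
    refine convexHull_min ?_ (convex_stdSimplex ℝ α)
    rintro _ ⟨i, rfl⟩
    exact single_mem_stdSimplex ℝ i
  exact ⟨(h hx).2, (h hx).1⟩

lemma stdSimplex_subset_stdSimplexSet : stdSimplex ℝ α ⊆ stdSimplexSet α := by
  rw [← convexHull_basis_eq_stdSimplex]
  refine convexHull_mono ?_
  rintro _ ⟨i, rfl⟩
  refine ⟨i, ?_⟩
  ext j
  simp [Pi.single_apply, eq_comm]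

lemma mem_smul_stdSimplexSet [Nonempty α] {u : ℕ} {x : α → ℝ} :
    x ∈ (u : ℝ) • stdSimplexSet α ↔ ∑ i, x i = u ∧ ∀ i, 0 ≤ x i := by
  constructor
  · rintro ⟨y, hy, rfl⟩
    obtain ⟨h1, h2⟩ := sum_eq_one_and_nonneg_of_mem_stdSimplexSet hy
    refine ⟨?_, fun i => ?_⟩
    · simp [← mul_sum, h1]
    · simpa using mul_nonneg (Nat.cast_nonneg u) (h2 i)
  · rintro ⟨h1, h2⟩
    rcases Nat.eq_zero_or_pos u with rfl | hu
    · obtain ⟨i⟩ := ‹Nonempty α›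
      have hx : x = 0 := by
        ext j
        exact (sum_eq_zero_iff_of_nonneg fun i _ => h2 i).1 (by simpa using h1) j (mem_univ j)
      exact ⟨Pi.single i 1, stdSimplex_subset_stdSimplexSet (single_mem_stdSimplex ℝ i),
        by simp [hx]⟩
    · have hu' : (u : ℝ) ≠ 0 := by positivity
      refine ⟨(u : ℝ)⁻¹ • x, stdSimplex_subset_stdSimplexSet ⟨fun i => ?_, ?_⟩, ?_⟩
      · exact mul_nonneg (by positivity) (h2 i)
      · simp [← mul_sum, h1, hu']
      · simp [smul_smul, hu']

lemma matroidPolytope_subset_polytope (M : PolyMatroid α) (hmat : ∀ i : α, M.rk {i} ≤ 1) :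
    matroidPolytope M ⊆ M.polytope := by
  refine convexHull_min ?_ ?_
  · rintro _ ⟨B, ⟨hB1, hB2⟩, rfl⟩
    refine ⟨by simp [indicatorVec, ← hB1, hB2], fun S => ?_⟩
    have h := M.rk_eq_card_of_subset hmat (inter_subset_right : S ∩ B ⊆ B) hB1
    have h' := M.rk_mono (inter_subset_left : S ∩ B ⊆ S)
    simp only [indicatorVec, sum_ite_mem, sum_const, nsmul_eq_mul, mul_one]
    rw [← h]
    exact_mod_cast h'
  · intro a ha b hb s t hs ht hst
    refine ⟨?_, fun S => ?_⟩
    · simp only [Pi.add_apply, Pi.smul_apply, smul_eq_mul, sum_add_distrib, ← mul_sum, ha.1, hb.1]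
      rw [← add_mul, hst, one_mul]
    · simp only [Pi.add_apply, Pi.smul_apply, smul_eq_mul, sum_add_distrib, ← mul_sum]
      calc _ ≤ s * M.rk S + t * M.rk S := by
            gcongr
            · exact ha.2 S
            · exact hb.2 S
        _ = _ := by rw [← add_mul, hst, one_mul]

/-- The lattice points of `P(M) + uΔ + t∇`. -/
lemma cast_mem_polytope_sum_iff [Nonempty α] (M : PolyMatroid α) (hmat : ∀ i : α, M.rk {i} ≤ 1)
    (t u : ℕ) (q : α → ℤ) :
    (fun i => (q i : ℝ)) ∈
      matroidPolytope M + (u : ℝ) • stdSimplexSet α + (t : ℝ) • (-stdSimplexSet α) ↔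
    M.excess q ≤ u ∧ ∑ i, q i = M.rk univ + u - t := by
  constructor
  · rintro ⟨_, ⟨p, hp, a, ha, rfl⟩, b, hb, hq⟩
    obtain ⟨hp1, hp2⟩ := matroidPolytope_subset_polytope M hmat hp
    obtain ⟨ha1, ha2⟩ := mem_smul_stdSimplexSet.1 ha
    rw [Set.smul_set_neg, Set.mem_neg] at hb
    obtain ⟨hb1, hb2⟩ := mem_smul_stdSimplexSet.1 hb
    simp only [Pi.neg_apply, sum_neg_distrib, Left.nonneg_neg_iff] at hb1 hb2
    have hq' : ∀ i, (q i : ℝ) = p i + a i + b i := fun i => (congrFun hq i).symm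
    constructor
    · have : (∑ i ∈ posSupport q, (q i : ℝ)) ≤ M.rk (posSupport q) + u := by
        simp only [hq', sum_add_distrib]
        have h1 := hp2 (posSupport q)
        have h2 : ∑ i ∈ posSupport q, a i ≤ ∑ i, a i :=
          sum_le_sum_of_subset_of_nonneg (subset_univ _) fun i _ _ => ha2 i
        have h3 : ∑ i ∈ posSupport q, b i ≤ 0 := sum_nonpos fun i _ => hb2 i
        linarith
      have h : (∑ i ∈ posSupport q, q i) ≤ M.rk (posSupport q) + u := by exact_mod_cast this
      unfold PolyMatroid.excess
      linarith
    · have : (∑ i, (q i : ℝ)) = M.rk univ + u - t := by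
        simp only [hq', sum_add_distrib]
        linarith
      exact_mod_cast this
  · rintro ⟨h1, h2⟩
    set T := posSupport q with hT
    obtain ⟨I, -, hIT, hI, hIr⟩ := M.exists_indep_extension hmat (empty_subset T)
      (by simp [M.rk_empty])
    obtain ⟨B, hIB, -, hB, hBr⟩ := M.exists_indep_extension hmat (subset_univ I) hI
    have hBT : B ∩ T = I := by
      have h3 := M.rk_eq_card_of_subset hmat (inter_subset_left : B ∩ T ⊆ B) hB
      have h4 := M.rk_mono (inter_subset_right : B ∩ T ⊆ T)
      exact (eq_of_subset_of_card_le (subset_inter hIB hIT) (by omega)).symm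
    obtain ⟨e⟩ := ‹Nonempty α›
    let d : α → ℤ := fun i => q i - if i ∈ B then 1 else 0
    have hdpos : ∀ i ∈ T, 0 ≤ d i := fun i hi => by
      have : 0 < q i := by simpa [hT, posSupport] using hi
      simp only [d]
      split_ifs <;> omega
    have hdneg : ∀ i ∉ T, d i ≤ 0 := fun i hi => by
      have : q i ≤ 0 := by simpa [hT, posSupport] using hi
      simp only [d]
      split_ifs <;> omega
    have hdT : ∑ i ∈ T, d i = M.excess q := by
      simp only [d, sum_sub_distrib, sum_ite_mem, sum_const, nsmul_eq_mul, mul_one,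
        PolyMatroid.excess, ← hT]
      rw [inter_comm, hBT, ← hI, hIr]
    have hd : ∑ i, d i = u - t := by
      simp only [d, sum_sub_distrib, sum_ite_mem, univ_inter, sum_const, nsmul_eq_mul, mul_one]
      rw [← hB, hBr, h2]
      ring
    have hsplit : ∀ f : α → ℤ, ∑ i, (if i ∈ T then f i else 0) = ∑ i ∈ T, f i := fun f => by
      simp
    let w : α → ℤ := Pi.single e (u - M.excess q)
    have hw : ∀ i, 0 ≤ w i := fun i => by
      by_cases hi : i = e
      · subst hi; simpa [w] using h1
      · simp [w, hi]
    have hws : ∑ i, w i = u - M.excess q := by simp [w]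
    let a : α → ℤ := fun i => (if i ∈ T then d i else 0) + w i
    have ha : ∀ i, 0 ≤ a i := fun i => by
      have := hw i
      by_cases hi : i ∈ T
      · have := hdpos i hi
        simp only [a, hi, if_true]; omega
      · simpa only [a, hi, if_false, zero_add]
    have hb : ∀ i, 0 ≤ a i - d i := fun i => by
      have := hw i
      by_cases hi : i ∈ T
      · simpa only [a, hi, if_true, add_sub_cancel_left]
      · have := hdneg i hi
        simp only [a, hi, if_false]; omega
    have has : ∑ i, a i = u := by
      simp only [a, sum_add_distrib, hsplit, hws, hdT]; ring
    have hbs : ∑ i, (a i - d i) = t := by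
      rw [sum_sub_distrib, has, hd]; ring
    refine ⟨_, ⟨indicatorVec B, subset_convexHull ℝ _ ⟨B, ⟨hB, hBr⟩, rfl⟩, fun i => (a i : ℝ),
      mem_smul_stdSimplexSet.2 ⟨by exact_mod_cast has, fun i => by exact_mod_cast ha i⟩, rfl⟩,
      -fun i => ((a i - d i : ℤ) : ℝ), ?_, ?_⟩
    · rw [Set.smul_set_neg, Set.neg_mem_neg]
      exact mem_smul_stdSimplexSet.2 ⟨by exact_mod_cast hbs, fun i => by exact_mod_cast hb i⟩
    · ext i
      simp only [Pi.add_apply, Pi.neg_apply, indicatorVec, d]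
      push_cast
      split_ifs <;> ring

lemma coeff_X_pow_mul_mk_one_pow {β : Type*} [DecidableEq β] (a k : ℕ) (S : Finset β) :
    PowerSeries.coeff k ((PowerSeries.X : PowerSeries ℚ) ^ a * PowerSeries.mk 1 ^ S.card) =
      if a ≤ k then ((finsuppAntidiag S (k - a)).card : ℚ) else 0 := by
  rw [PowerSeries.coeff_X_pow_mul', ← prod_const, PowerSeries.coeff_prod]
  simp

/-- The lattice points of excess `u` that fall `t` short of rank `r(M)` once the excess is
removed. -/
def PolyMatroid.layer (M : PolyMatroid α) (t u : ℕ) : Set (α → ℤ) :=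
  {q | M.excess q = u ∧ ∑ i, q i = M.rk univ + u - t}

lemma PolyMatroid.excess_nonneg (M : PolyMatroid α) (hmat : ∀ i : α, M.rk {i} ≤ 1)
    (q : α → ℤ) : 0 ≤ M.excess q := by
  have h1 : (M.rk (posSupport q) : ℤ) ≤ (posSupport q).card := by
    exact_mod_cast M.rk_le_card hmat _
  have h2 : ∑ i ∈ posSupport q, (1 : ℤ) ≤ ∑ i ∈ posSupport q, q i :=
    sum_le_sum fun i hi => by
      have : 0 < q i := by simpa [posSupport] using hi
      omega
  simp only [sum_const, nsmul_eq_mul, mul_one] at h2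
  unfold PolyMatroid.excess
  omega

lemma sum_le_sum_posSupport (q : α → ℤ) : ∑ i, q i ≤ ∑ i ∈ posSupport q, q i := by
  rw [← sum_add_sum_compl (posSupport q)]
  have : ∑ i ∈ (posSupport q)ᶜ, q i ≤ 0 :=
    sum_nonpos fun i hi => by simpa [posSupport] using hi
  omega

lemma PolyMatroid.sum_le_rk_add_excess (M : PolyMatroid α) (q : α → ℤ) :
    ∑ i, q i ≤ M.rk univ + M.excess q := by
  have h1 := sum_le_sum_posSupport q
  have h2 : (M.rk (posSupport q) : ℤ) ≤ M.rk univ := by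
    exact_mod_cast M.rk_mono (subset_univ _)
  unfold PolyMatroid.excess
  omega

lemma PolyMatroid.finite_setOf_excess_le (M : PolyMatroid α) (u s : ℤ) :
    {q : α → ℤ | M.excess q ≤ u ∧ ∑ i, q i = s}.Finite := by
  refine (Set.finite_Icc (fun _ : α => -(M.rk univ + u) + s)
    (fun _ : α => (M.rk univ + u : ℤ))).subset ?_
  rintro q ⟨h1, h2⟩
  have h3 : (M.rk (posSupport q) : ℤ) ≤ M.rk univ := by
    exact_mod_cast M.rk_mono (subset_univ _)
  have hpos : ∀ i ∈ posSupport q, 0 ≤ q i := fun i hi => by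
    have : 0 < q i := by simpa [posSupport] using hi
    omega
  have hneg : ∀ i ∈ (posSupport q)ᶜ, q i ≤ 0 := fun i hi => by
    simpa [posSupport] using hi
  have h4 := sum_nonneg hpos
  have h5 := sum_nonpos hneg
  have h6 := sum_add_sum_compl (posSupport q) q
  unfold PolyMatroid.excess at h1
  refine ⟨fun i => ?_, fun i => ?_⟩ <;> by_cases hi : i ∈ posSupport q
  · have := hpos i hi
    dsimp only; omega
  · have := single_le_sum (f := fun i => - q i) (fun i hi => neg_nonneg.2 (hneg i hi))
      (mem_compl.2 hi)
    simp only [sum_neg_distrib] at this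
    dsimp only; omega
  · have := single_le_sum hpos hi
    dsimp only; omega
  · have := hneg i (mem_compl.2 hi)
    dsimp only; omega

/-- The vector which is positive exactly on `S`, with given deviations from `1` and `0`. -/
def assemble {β : Type*} [DecidableEq β] (S : Finset β) (p : (β →₀ ℕ) × (β →₀ ℕ)) : β → ℤ :=
  fun i => if i ∈ S then (p.1 i : ℤ) + 1 else -(p.2 i : ℤ)

lemma posSupport_assemble (S : Finset α) (p : (α →₀ ℕ) × (α →₀ ℕ)) :
    posSupport (assemble S p) = S := by
  ext i
  simp only [posSupport, mem_filter, mem_univ, true_and]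
  by_cases h : i ∈ S <;> simp only [assemble, h, if_true, if_false, iff_true, iff_false] <;> omega

lemma sum_assemble {β : Type*} [DecidableEq β] (S : Finset β) (p : (β →₀ ℕ) × (β →₀ ℕ)) :
    ∑ i ∈ S, assemble S p i = ((S.sum p.1 : ℕ) : ℤ) + S.card := by
  rw [sum_congr rfl fun i hi => show assemble S p i = (p.1 i : ℤ) + 1 by simp [assemble, hi]]
  simp [sum_add_distrib]

lemma sum_compl_assemble (S : Finset α) (p : (α →₀ ℕ) × (α →₀ ℕ)) :
    ∑ i ∈ Sᶜ, assemble S p i = -((Sᶜ.sum p.2 : ℕ) : ℤ) := by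
  rw [sum_congr rfl fun i hi => show assemble S p i = -(p.2 i : ℤ) by
    simp [assemble, mem_compl.1 hi]]
  simp

lemma mem_layer_and_posSupport_iff (M : PolyMatroid α) (S : Finset α) (t u : ℕ) (q : α → ℤ) :
    (q ∈ M.layer t u ∧ posSupport q = S) ↔
      posSupport q = S ∧ ∑ i ∈ S, q i = M.rk S + u ∧
        ∑ i ∈ Sᶜ, q i = M.rk univ - M.rk S - t := by
  have h := sum_add_sum_compl S q
  constructor
  · rintro ⟨⟨h1, h2⟩, rfl⟩
    unfold PolyMatroid.excess at h1
    exact ⟨rfl, by omega, by omega⟩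
  · rintro ⟨rfl, h1, h2⟩
    exact ⟨⟨by unfold PolyMatroid.excess; omega, by omega⟩, rfl⟩

lemma ncard_layer_posSupport (M : PolyMatroid α) (hmat : ∀ i : α, M.rk {i} ≤ 1)
    (S : Finset α) (t u : ℕ) :
    ({q | q ∈ M.layer t u ∧ posSupport q = S}.ncard : ℚ) =
      PowerSeries.coeff t ((PowerSeries.X : PowerSeries ℚ) ^ (M.rk univ - M.rk S) *
        PowerSeries.mk 1 ^ Sᶜ.card) *
      PowerSeries.coeff u ((PowerSeries.X : PowerSeries ℚ) ^ (S.card - M.rk S) *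
        PowerSeries.mk 1 ^ S.card) := by
  have hr := M.rk_mono (subset_univ S)
  have hS := M.rk_le_card hmat S
  rw [coeff_X_pow_mul_mk_one_pow, coeff_X_pow_mul_mk_one_pow]
  by_cases hle : M.rk univ - M.rk S ≤ t ∧ S.card - M.rk S ≤ u
  · obtain ⟨ht, hu⟩ := hle
    rw [if_pos ht, if_pos hu, ← Nat.cast_mul, mul_comm, ← card_product]
    congr 1
    have hset : {q | q ∈ M.layer t u ∧ posSupport q = S} = assemble S ''
        ((finsuppAntidiag S (u - (S.card - M.rk S)) ×ˢ
          finsuppAntidiag Sᶜ (t - (M.rk univ - M.rk S)) : Finset _) : Set _) := by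
      ext q
      rw [Set.mem_ofPred_eq, mem_layer_and_posSupport_iff]
      constructor
      · rintro ⟨rfl, h1, h2⟩
        set S := posSupport q with hSq
        let p : (α →₀ ℕ) × (α →₀ ℕ) :=
          (Finsupp.equivFunOnFinite.symm fun i => if i ∈ S then (q i - 1).toNat else 0,
           Finsupp.equivFunOnFinite.symm fun i => if i ∈ S then 0 else (-q i).toNat)
        have hp : assemble S p = q := by
          ext i
          by_cases hi : i ∈ S
          · have : 0 < q i := by simpa [hSq, posSupport] using hi
            simp only [assemble, p, hi, if_true, Finsupp.equivFunOnFinite_symm_apply_apply]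
            omega
          · have : q i ≤ 0 := by simpa [hSq, posSupport] using hi
            simp only [assemble, p, hi, if_false, Finsupp.equivFunOnFinite_symm_apply_apply]
            omega
        refine ⟨p, ?_, hp⟩
        have h3 := sum_assemble S p
        have h4 := sum_compl_assemble S p
        rw [hp] at h3 h4
        simp only [coe_product, Set.mem_prod, mem_coe, mem_finsuppAntidiag]
        refine ⟨⟨by omega, fun i hi => ?_⟩, by omega, fun i hi => ?_⟩ <;>
        · by_contra hiS
          simp [p] at hi hiS
          tauto
      · rintro ⟨p, hp, rfl⟩
        simp only [coe_product, Set.mem_prod, mem_coe, mem_finsuppAntidiag] at hp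
        refine ⟨posSupport_assemble S p, ?_, ?_⟩
        · rw [sum_assemble]; omega
        · rw [sum_compl_assemble]; omega
    rw [hset, Set.InjOn.ncard_image, Set.ncard_coe_finset]
    rintro p hp p' hp' heq
    simp only [coe_product, Set.mem_prod, mem_coe, mem_finsuppAntidiag] at hp hp'
    have key : ∀ i, p.1 i = p'.1 i ∧ p.2 i = p'.2 i := fun i => by
      have h := congrFun heq i
      have hz : ∀ (f : α →₀ ℕ) (U : Finset α), f.support ⊆ U → i ∉ U → f i = 0 :=
        fun f U hf hi => Finsupp.notMem_support_iff.1 fun h => hi (hf h)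
      by_cases hi : i ∈ S
      · have hi' : i ∉ Sᶜ := by simpa using hi
        simp only [assemble, hi, if_true] at h
        exact ⟨by omega, by rw [hz _ _ hp.2.2 hi', hz _ _ hp'.2.2 hi']⟩
      · simp only [assemble, hi, if_false] at h
        exact ⟨by rw [hz _ _ hp.1.2 hi, hz _ _ hp'.1.2 hi], by omega⟩
    exact Prod.ext (Finsupp.ext fun i => (key i).1) (Finsupp.ext fun i => (key i).2)
  · have hempty : {q | q ∈ M.layer t u ∧ posSupport q = S} = ∅ := by
      ext q
      rw [Set.mem_ofPred_eq, mem_layer_and_posSupport_iff]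
      simp only [Set.mem_empty_iff_false, iff_false]
      rintro ⟨rfl, h1, h2⟩
      have h3 : ∑ i ∈ posSupport q, (1 : ℤ) ≤ ∑ i ∈ posSupport q, q i :=
        sum_le_sum fun i hi => by
          have : 0 < q i := by simpa [posSupport] using hi
          omega
      have h4 : ∑ i ∈ (posSupport q)ᶜ, q i ≤ 0 :=
        sum_nonpos fun i hi => by simpa [posSupport] using hi
      simp only [sum_const, nsmul_eq_mul, mul_one] at h3
      omega
    rw [hempty, Set.ncard_empty, Nat.cast_zero, eq_comm, mul_eq_zero]
    by_cases ht : M.rk univ - M.rk S ≤ t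
    · exact Or.inr (if_neg fun hu => hle ⟨ht, hu⟩)
    · exact Or.inl (if_neg ht)

lemma finite_layer (M : PolyMatroid α) (t u : ℕ) : (M.layer t u).Finite :=
  (M.finite_setOf_excess_le u (M.rk univ + u - t)).subset fun _ h => ⟨h.1.le, h.2⟩

lemma ncard_layer (M : PolyMatroid α) (hmat : ∀ i : α, M.rk {i} ≤ 1) (t u : ℕ) :
    ((M.layer t u).ncard : ℚ) = ∑ S : Finset α,
      PowerSeries.coeff t ((PowerSeries.X : PowerSeries ℚ) ^ (M.rk univ - M.rk S) *
        PowerSeries.mk 1 ^ Sᶜ.card) *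
      PowerSeries.coeff u ((PowerSeries.X : PowerSeries ℚ) ^ (S.card - M.rk S) *
        PowerSeries.mk 1 ^ S.card) := by
  have hfin := finite_layer M t u
  rw [Set.ncard_eq_toFinset_card _ hfin,
    card_eq_sum_card_fiberwise (f := posSupport) (t := univ) (fun _ _ => by simp), Nat.cast_sum]
  refine sum_congr rfl fun S _ => ?_
  rw [← ncard_layer_posSupport M hmat S t u, ← Set.ncard_coe_finset]
  congr 2
  ext q
  simp

lemma Qcount_eq_ncard [Nonempty α] (M : PolyMatroid α) (hmat : ∀ i : α, M.rk {i} ≤ 1)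
    (t u : ℕ) : Qcount (matroidPolytope M) t u =
      {q : α → ℤ | M.excess q ≤ u ∧ ∑ i, q i = M.rk univ + u - t}.ncard := by
  unfold Qcount latticeCount
  congr 1
  ext q
  exact cast_mem_polytope_sum_iff M hmat t u q

lemma Qcount_zero_left [Nonempty α] (M : PolyMatroid α) (hmat : ∀ i : α, M.rk {i} ≤ 1)
    (u : ℕ) : Qcount (matroidPolytope M) 0 u = (M.layer 0 u).ncard := by
  rw [Qcount_eq_ncard M hmat]
  congr 1
  ext q
  have := M.sum_le_rk_add_excess q
  simp only [PolyMatroid.layer, Set.mem_ofPred_eq]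
  omega

lemma Qcount_zero_right [Nonempty α] (M : PolyMatroid α) (hmat : ∀ i : α, M.rk {i} ≤ 1)
    (t : ℕ) : Qcount (matroidPolytope M) t 0 = (M.layer t 0).ncard := by
  rw [Qcount_eq_ncard M hmat]
  congr 1
  ext q
  have := M.excess_nonneg hmat q
  simp only [PolyMatroid.layer, Set.mem_ofPred_eq]
  omega

lemma Qcount_succ_succ [Nonempty α] (M : PolyMatroid α) (hmat : ∀ i : α, M.rk {i} ≤ 1)
    (t u : ℕ) : Qcount (matroidPolytope M) (t + 1) (u + 1) =
      Qcount (matroidPolytope M) t u + (M.layer (t + 1) (u + 1)).ncard := by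
  rw [Qcount_eq_ncard M hmat, Qcount_eq_ncard M hmat, ← Set.ncard_union_eq
    (Set.disjoint_left.2 ?_) (M.finite_setOf_excess_le _ _) (finite_layer M _ _)]
  · congr 1
    ext q
    simp only [PolyMatroid.layer, Set.mem_ofPred_eq, Set.mem_union]
    push_cast
    omega
  · rintro q ⟨h1, -⟩ ⟨h2, -⟩
    push_cast at h2
    omega

/-- Univariate power series as series in the outer variable of `ℚ⟦Y⟧⟦X⟧`. -/
def outerSeries : PowerSeries ℚ →+* PowerSeries (PowerSeries ℚ) :=
  PowerSeries.map PowerSeries.C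

/-- Univariate power series as series in the inner variable of `ℚ⟦Y⟧⟦X⟧`. -/
def innerSeries : PowerSeries ℚ →+* PowerSeries (PowerSeries ℚ) :=
  PowerSeries.C

lemma coeff_coeff_outer_mul_inner (f g : PowerSeries ℚ) (t u : ℕ) :
    PowerSeries.coeff u (PowerSeries.coeff t (outerSeries f * innerSeries g)) =
      PowerSeries.coeff t f * PowerSeries.coeff u g := by
  simp [outerSeries, innerSeries, PowerSeries.coeff_mul_C]

/-- Bivariate polynomials as iterated power series. -/
def bivariateToSeries : Polynomial (Polynomial ℚ) →+* PowerSeries (PowerSeries ℚ) :=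
  Polynomial.coeToPowerSeries.ringHom.comp
    (Polynomial.mapRingHom Polynomial.coeToPowerSeries.ringHom)

lemma bivariateToSeries_injective : Function.Injective bivariateToSeries :=
  (Polynomial.coe_injective _).comp (Polynomial.map_injective _ (Polynomial.coe_injective ℚ))

lemma bivariateToSeries_map_C (p : Polynomial ℚ) :
    bivariateToSeries (p.map Polynomial.C) = outerSeries p := by
  ext t u
  simp [bivariateToSeries, outerSeries, PowerSeries.coeff_C]

lemma bivariateToSeries_C (p : Polynomial ℚ) :
    bivariateToSeries (Polynomial.C p) = innerSeries p := by
  simp [bivariateToSeries, innerSeries]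

lemma mk_choose_mul_one_sub_pow (i : ℕ) :
    (PowerSeries.mk fun t => (t.choose i : ℚ)) * (1 - PowerSeries.X) ^ (i + 1) =
      PowerSeries.X ^ i := by
  have h : (PowerSeries.mk fun t => (t.choose i : ℚ)) =
      PowerSeries.X ^ i * PowerSeries.mk fun n => (Nat.choose (i + n) i : ℚ) := by
    ext t
    rw [PowerSeries.coeff_X_pow_mul', PowerSeries.coeff_mk]
    split_ifs with hit
    · rw [PowerSeries.coeff_mk, Nat.add_sub_cancel' hit]
    · rw [Nat.choose_eq_zero_of_lt (not_le.1 hit), Nat.cast_zero]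
  rw [h, mul_assoc, PowerSeries.mk_add_choose_mul_one_sub_pow_eq_one, mul_one]

lemma mk_choose_mul_one_sub_pow_of_lt {i K : ℕ} (h : i < K) :
    (PowerSeries.mk fun t => (t.choose i : ℚ)) * (1 - PowerSeries.X) ^ K =
      ((Polynomial.X ^ i * (1 - Polynomial.X) ^ (K - 1 - i) : Polynomial ℚ) : PowerSeries ℚ) := by
  obtain ⟨m, rfl⟩ := Nat.exists_eq_add_of_lt h
  rw [show i + m + 1 = i + 1 + m by ring, pow_add, ← mul_assoc, mk_choose_mul_one_sub_pow,
    show i + 1 + m - 1 - i = m by omega]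
  simp

lemma X_pow_mul_mk_one_pow_mul_one_sub_pow (a : ℕ) {m K : ℕ} (h : m ≤ K) :
    (PowerSeries.X ^ a * PowerSeries.mk 1 ^ m : PowerSeries ℚ) * (1 - PowerSeries.X) ^ K =
      ((Polynomial.X ^ a * (1 - Polynomial.X) ^ (K - m) : Polynomial ℚ) : PowerSeries ℚ) := by
  obtain ⟨k, rfl⟩ := Nat.exists_eq_add_of_le h
  rw [pow_add, mul_assoc, ← mul_assoc (PowerSeries.mk 1 ^ m), ← mul_pow,
    PowerSeries.mk_one_mul_one_sub_eq_one, one_pow, one_mul, Nat.add_sub_cancel_left]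
  simp

/-- An iterated power series identity between sums of products of rational functions with poles
at `1` specialises to an identity of values. -/
lemma generating_identity_eval {ι κ : Type*} (s : Finset ι) (T : Finset κ) (c : ι → ℚ)
    (i j : ι → ℕ) (a b m k : κ → ℕ)
    (h : (1 - outerSeries PowerSeries.X * innerSeries PowerSeries.X) *
        ∑ l ∈ s, PowerSeries.C (PowerSeries.C (c l)) *
          (outerSeries (PowerSeries.mk fun t => (t.choose (i l) : ℚ)) *
            innerSeries (PowerSeries.mk fun t => (t.choose (j l) : ℚ))) =
      ∑ l ∈ T, outerSeries (PowerSeries.X ^ a l * PowerSeries.mk 1 ^ m l) *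
        innerSeries (PowerSeries.X ^ b l * PowerSeries.mk 1 ^ k l))
    {v w : ℚ} (hv : v ≠ 1) (hw : w ≠ 1) :
    (1 - v * w) * ∑ l ∈ s, c l *
        (v ^ i l * (1 - v)⁻¹ ^ (i l + 1) * (w ^ j l * (1 - w)⁻¹ ^ (j l + 1))) =
      ∑ l ∈ T, v ^ a l * (1 - v)⁻¹ ^ m l * (w ^ b l * (1 - w)⁻¹ ^ k l) := by
  have hv' : 1 - v ≠ 0 := sub_ne_zero.2 hv.symm
  have hw' : 1 - w ≠ 0 := sub_ne_zero.2 hw.symm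
  obtain ⟨K, hK₁, hK₂⟩ : ∃ K, (∀ l ∈ s, i l < K ∧ j l < K) ∧ ∀ l ∈ T, m l ≤ K ∧ k l ≤ K := by
    refine ⟨∑ l ∈ s, (i l + j l + 1) + ∑ l ∈ T, (m l + k l), fun l hl => ?_, fun l hl => ?_⟩
    · have := single_le_sum (f := fun l => i l + j l + 1) (fun _ _ => Nat.zero_le _) hl
      omega
    · have := single_le_sum (f := fun l => m l + k l) (fun _ _ => Nat.zero_le _) hl
      omega
  let P (n e : ℕ) : Polynomial ℚ := Polynomial.X ^ n * (1 - Polynomial.X) ^ e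
  have hpoly : (1 - (Polynomial.X : Polynomial ℚ).map Polynomial.C * Polynomial.C Polynomial.X) *
        ∑ l ∈ s, Polynomial.C (Polynomial.C (c l)) *
          ((P (i l) (K - 1 - i l)).map Polynomial.C * Polynomial.C (P (j l) (K - 1 - j l))) =
      ∑ l ∈ T, (P (a l) (K - m l)).map Polynomial.C * Polynomial.C (P (b l) (K - k l)) := by
    apply bivariateToSeries_injective
    have h' := congrArg (· * (outerSeries ((1 - PowerSeries.X) ^ K) *
      innerSeries ((1 - PowerSeries.X) ^ K))) h
    simp only [mul_assoc, sum_mul] at h'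
    simp only [map_mul, map_sub, map_one, map_sum, bivariateToSeries_map_C, bivariateToSeries_C,
      Polynomial.coe_X]
    convert h' using 2
    · refine sum_congr rfl fun l hl => ?_
      rw [← mk_choose_mul_one_sub_pow_of_lt (hK₁ l hl).1,
        ← mk_choose_mul_one_sub_pow_of_lt (hK₁ l hl).2, map_mul, map_mul]
      simp only [innerSeries, Polynomial.coe_C]
      ring
    · rename_i l hl
      rw [← X_pow_mul_mk_one_pow_mul_one_sub_pow _ (hK₂ l hl).1,
        ← X_pow_mul_mk_one_pow_mul_one_sub_pow _ (hK₂ l hl).2]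
      simp only [map_mul]
      ring
  have heval := congrArg (Polynomial.evalEvalRingHom w v) hpoly
  simp only [map_mul, map_sub, map_one, map_sum, Polynomial.coe_evalEvalRingHom,
    Polynomial.evalEval_map_C, Polynomial.evalEval_C, Polynomial.eval_C, Polynomial.eval_X, P,
    Polynomial.eval_mul, Polynomial.eval_pow, Polynomial.eval_sub, Polynomial.eval_one] at heval
  have hinv : ∀ {z : ℚ}, 1 - z ≠ 0 → ∀ {e : ℕ}, e ≤ K →
      (1 - z)⁻¹ ^ e = (1 - z) ^ (K - e) * (1 - z)⁻¹ ^ K := fun {z} hz e he => by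
    obtain ⟨d, rfl⟩ := Nat.exists_eq_add_of_le he
    rw [Nat.add_sub_cancel_left, pow_add, mul_left_comm, ← mul_pow, mul_inv_cancel₀ hz, one_pow,
      mul_one]
  have heval' := congrArg (· * ((1 - v)⁻¹ ^ K * (1 - w)⁻¹ ^ K)) heval
  simp only [mul_assoc, sum_mul] at heval'
  convert heval' using 2
  · refine sum_congr rfl fun l hl => ?_
    rw [hinv hv' (hK₁ l hl).1, hinv hw' (hK₁ l hl).2, Nat.sub_sub, Nat.sub_sub, add_comm 1,
      add_comm 1]
    ring
  · rename_i l hl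
    rw [hinv hv' (hK₂ l hl).1, hinv hw' (hK₂ l hl).2]
    ring

lemma ext_of_one_sub_mul {G H : PowerSeries (PowerSeries ℚ)}
    (hl : ∀ u, PowerSeries.coeff u (PowerSeries.coeff 0 G) =
      PowerSeries.coeff u (PowerSeries.coeff 0 H))
    (hr : ∀ t, PowerSeries.coeff 0 (PowerSeries.coeff t G) =
      PowerSeries.coeff 0 (PowerSeries.coeff t H))
    (hs : ∀ t u, PowerSeries.coeff (u + 1) (PowerSeries.coeff (t + 1) G) =
      PowerSeries.coeff u (PowerSeries.coeff t G) +
        PowerSeries.coeff (u + 1) (PowerSeries.coeff (t + 1) H)) :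
    (1 - outerSeries PowerSeries.X * innerSeries PowerSeries.X) * G = H := by
  have hX : outerSeries PowerSeries.X = PowerSeries.X := by simp [outerSeries]
  ext t u
  rw [sub_mul, one_mul, mul_assoc, hX, map_sub, map_sub]
  rcases t with _ | t
  · rw [PowerSeries.coeff_zero_X_mul, map_zero, sub_zero, hl]
  rw [PowerSeries.coeff_succ_X_mul, innerSeries, PowerSeries.coeff_C_mul]
  rcases u with _ | u
  · rw [PowerSeries.coeff_zero_X_mul, sub_zero, hr]
  rw [PowerSeries.coeff_succ_X_mul, hs, add_sub_cancel_left]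

lemma Qprime_eq_sum_subsets [Nonempty α] (M : PolyMatroid α) (hmat : ∀ i : α, M.rk {i} ≤ 1)
    {c : ℕ × ℕ → ℤ} (hc : IsQdatum (matroidPolytope M) c) {v w : ℚ} (hv : v ≠ 1) (hw : w ≠ 1) :
    (1 - v * w) * ((1 - v)⁻¹ * (1 - w)⁻¹ * Qprime c (1 - v)⁻¹ (1 - w)⁻¹) =
      ∑ S : Finset α, v ^ (M.rk univ - M.rk S) * (1 - v)⁻¹ ^ Sᶜ.card *
        (w ^ (S.card - M.rk S) * (1 - w)⁻¹ ^ S.card) := by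
  obtain ⟨hfin, hQ⟩ := hc
  set s := hfin.toFinset with hs
  have hQ' : ∀ t u, (Qcount (matroidPolytope M) t u : ℚ) =
      ∑ p ∈ s, (c p : ℚ) * ((t.choose p.1 : ℚ) * (u.choose p.2 : ℚ)) := fun t u => by
    have h := hQ t u
    rw [finsum_eq_sum_of_support_subset (s := s)] at h
    · have h' := congrArg (Int.cast : ℤ → ℚ) h
      push_cast at h'
      simpa only [mul_assoc] using h'
    · intro p hp
      simp only [hs, Set.Finite.coe_toFinset, Function.mem_support] at hp ⊢
      intro h0
      simp [h0] at hp
  have hQp : Qprime c (1 - v)⁻¹ (1 - w)⁻¹ =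
      ∑ p ∈ s, (c p : ℚ) * ((1 - v)⁻¹ - 1) ^ p.1 * ((1 - w)⁻¹ - 1) ^ p.2 := by
    unfold Qprime
    refine finsum_eq_sum_of_support_subset _ fun p hp => ?_
    simp only [hs, Set.Finite.coe_toFinset, Function.mem_support] at hp ⊢
    intro h0
    simp [h0] at hp
  have hcoeffG : ∀ t u, PowerSeries.coeff u (PowerSeries.coeff t
      (∑ p ∈ s, PowerSeries.C (PowerSeries.C (c p : ℚ)) *
        (outerSeries (PowerSeries.mk fun t => (t.choose p.1 : ℚ)) *
          innerSeries (PowerSeries.mk fun t => (t.choose p.2 : ℚ))))) =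
      (Qcount (matroidPolytope M) t u : ℚ) := fun t u => by
    simp only [map_sum, PowerSeries.coeff_C_mul, coeff_coeff_outer_mul_inner,
      PowerSeries.coeff_mk, hQ']
  have hcoeffH : ∀ t u, PowerSeries.coeff u (PowerSeries.coeff t
      (∑ S : Finset α, outerSeries (PowerSeries.X ^ (M.rk univ - M.rk S) *
          PowerSeries.mk 1 ^ Sᶜ.card) *
        innerSeries (PowerSeries.X ^ (S.card - M.rk S) * PowerSeries.mk 1 ^ S.card))) =
      ((M.layer t u).ncard : ℚ) := fun t u => by
    simp only [map_sum, coeff_coeff_outer_mul_inner, ncard_layer M hmat]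
  have key := generating_identity_eval s univ (fun p => (c p : ℚ)) Prod.fst Prod.snd
    (fun S => M.rk univ - M.rk S) (fun S => S.card - M.rk S) (fun S => Sᶜ.card) Finset.card
    (ext_of_one_sub_mul
      (fun u => by rw [hcoeffG, hcoeffH, Qcount_zero_left M hmat])
      (fun t => by rw [hcoeffG, hcoeffH, Qcount_zero_right M hmat])
      (fun t u => by
        rw [hcoeffG, hcoeffG, hcoeffH, Qcount_succ_succ M hmat, Nat.cast_add])) hv hw
  have hsub : ∀ {z : ℚ}, z ≠ 1 → (1 - z)⁻¹ - 1 = z * (1 - z)⁻¹ := fun {z} hz => by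
    have : 1 - z ≠ 0 := sub_ne_zero.2 hz.symm
    field_simp
    ring
  rw [← key, hQp, mul_sum]
  congr 1
  refine sum_congr rfl fun p _ => ?_
  rw [hsub hv, hsub hw, mul_pow, mul_pow]
  ring

lemma Tutte_summand_transform {x y D : ℚ} (hx : x ≠ 0) (hy : y ≠ 0) (hD : D ≠ 0)
    {r k m n : ℕ} (hkr : k ≤ r) (hkm : k ≤ m) (hrm : r + m ≤ n + k) :
    D ^ n * ((y * (x - 1) / x) ^ (r - k) * (-x / D) ^ (n - m) *
        ((x * (y - 1) / y) ^ (m - k) * (-y / D) ^ m)) =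
      (-y) ^ r * (-x) ^ (n - r) * ((x - 1) ^ (r - k) * (y - 1) ^ (m - k)) := by
  obtain ⟨a, rfl⟩ := Nat.exists_eq_add_of_le hkr
  obtain ⟨b, rfl⟩ := Nat.exists_eq_add_of_le hkm
  obtain ⟨e, rfl⟩ : ∃ e, n = k + a + b + e := ⟨n - (k + a + b), by omega⟩
  rw [show k + a + b + e - (k + b) = a + e by omega, show k + a + b + e - (k + a) = b + e by omega,
    Nat.add_sub_cancel_left, Nat.add_sub_cancel_left]
  rw [neg_div, neg_div, neg_pow (x / D), neg_pow (y / D), neg_pow x, neg_pow y]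
  simp only [div_pow, mul_pow, pow_add]
  field_simp

/-- The inversion formula recovering the Tutte polynomial from `Q'_M`:
`(−y)^{r(M)} (−x)^{n−r(M)} T_M(x,y) = −xy (xy−x−y)^{n−1} Q'_M(−x/(xy−x−y), −y/(xy−x−y))`. -/
theorem stmt_2 {α : Type*} [Fintype α] [DecidableEq α] [Nonempty α]
    (M : PolyMatroid α) (hmat : ∀ i : α, M.rk {i} ≤ 1)
    (c : ℕ × ℕ → ℤ) (hc : IsQdatum (matroidPolytope M) c)
    (x y : ℚ) (hx : x ≠ 0) (hy : y ≠ 0) (hxy : x * y - x - y ≠ 0) :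
    (-y) ^ (M.rk Finset.univ) * (-x) ^ (Fintype.card α - M.rk Finset.univ) *
        TuttePoly M x y =
      -(x * y) * (x * y - x - y) ^ (Fintype.card α - 1) *
        Qprime c (-x / (x * y - x - y)) (-y / (x * y - x - y)) := by
  set D := x * y - x - y with hD
  have hv : (1 - y * (x - 1) / x)⁻¹ = -x / D := by
    rw [show 1 - y * (x - 1) / x = -D / x by rw [hD]; field_simp; ring, inv_div, div_neg, neg_div]
  have hw : (1 - x * (y - 1) / y)⁻¹ = -y / D := by
    rw [show 1 - x * (y - 1) / y = -D / y by rw [hD]; field_simp; ring, inv_div, div_neg, neg_div]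
  have hne : ∀ {z q : ℚ}, q ≠ 0 → (1 - z)⁻¹ = -q / D → z ≠ 1 := fun {z q} hq h hz => by
    rw [hz, sub_self, inv_zero, eq_comm, div_eq_zero_iff, neg_eq_zero] at h
    tauto
  have key := Qprime_eq_sum_subsets M hmat hc (hne hx hv) (hne hy hw)
  rw [hv, hw, show 1 - y * (x - 1) / x * (x * (y - 1) / y) = -D by rw [hD]; field_simp; ring]
    at key
  have hn : D ^ Fintype.card α = D ^ (Fintype.card α - 1) * D := by
    rw [← pow_succ, Nat.sub_add_cancel Fintype.card_pos]
  calc _ = D ^ Fintype.card α * ∑ S : Finset α, (y * (x - 1) / x) ^ (M.rk univ - M.rk S) *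
          (-x / D) ^ Sᶜ.card * ((x * (y - 1) / y) ^ (S.card - M.rk S) * (-y / D) ^ S.card) := by
        rw [TuttePoly, mul_sum, mul_sum]
        refine sum_congr rfl fun S _ => ?_
        rw [card_compl, Tutte_summand_transform hx hy hxy (M.rk_mono (subset_univ S))
          (M.rk_le_card hmat S)]
        have h := M.rk_union_le_add_card hmat S Sᶜ
        rw [union_compl, card_compl] at h
        have := card_le_univ S
        omega
    _ = _ := by
        rw [← key, hn]
        field_simp

end
end

section
/- Let M = (E,r) be a polymatroid on a nonempty finite set E. Then there exists a polynomial q in two variables with rational coefficients, of total degree |E| − 1, such that for all nonnegative integers t, u, the number of points of ℤ^E in P(M) + uΔ + t∇ equals q(t,u). -/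
open scoped Pointwise
open Finset

noncomputable section

variable {α : Type*} [Fintype α] [DecidableEq α]

set_option linter.unusedSectionVars false

/-- The function `(t, u) ↦ (t choose i) * (u choose j)`. -/
def chooseMul (i j : ℕ) : ℕ → ℕ → ℚ := fun t u => (t.choose i : ℚ) * (u.choose j : ℚ)

/-- The span of the products of binomial coefficients of total degree at most `d`. -/
def chooseSpan (d : ℕ) : Submodule ℚ (ℕ → ℕ → ℚ) :=
  Submodule.span ℚ {F | ∃ i j, i + j ≤ d ∧ F = chooseMul i j}

/-- The span of the products of binomial coefficients of total degree at most `d` whose degree in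
the first variable is less than `d`. -/
def chooseSpanLT (d : ℕ) : Submodule ℚ (ℕ → ℕ → ℚ) :=
  Submodule.span ℚ {F | ∃ i j, i + j ≤ d ∧ i < d ∧ F = chooseMul i j}

/-- Summation over the first variable. -/
def sumFst : (ℕ → ℕ → ℚ) →ₗ[ℚ] (ℕ → ℕ → ℚ) where
  toFun F t u := ∑ s ∈ range t, F s u
  map_add' F G := by ext t u; simp [sum_add_distrib]
  map_smul' a F := by ext t u; simp [mul_sum]

/-- Summation over the second variable. -/
def sumSnd : (ℕ → ℕ → ℚ) →ₗ[ℚ] (ℕ → ℕ → ℚ) where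
  toFun F t u := ∑ s ∈ range u, F t s
  map_add' F G := by ext t u; simp [sum_add_distrib]
  map_smul' a F := by ext t u; simp [mul_sum]

lemma sum_range_choose_fixed (n k : ℕ) : ∑ m ∈ range n, m.choose k = n.choose (k + 1) := by
  induction n with
  | zero => simp
  | succ n ih => rw [sum_range_succ, ih, Nat.choose_succ_succ, add_comm]

lemma sumFst_chooseMul (i j : ℕ) : sumFst (chooseMul i j) = chooseMul (i + 1) j := by
  ext t u
  simp only [sumFst, chooseMul, LinearMap.coe_mk, AddHom.coe_mk, ← sum_mul,
    ← sum_range_choose_fixed t i]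
  push_cast
  rfl

lemma sumSnd_chooseMul (i j : ℕ) : sumSnd (chooseMul i j) = chooseMul i (j + 1) := by
  ext t u
  simp only [sumSnd, chooseMul, LinearMap.coe_mk, AddHom.coe_mk, ← mul_sum,
    ← sum_range_choose_fixed u j]
  push_cast
  rfl

lemma chooseSpanLT_le_chooseSpan (d : ℕ) : chooseSpanLT d ≤ chooseSpan d :=
  Submodule.span_mono fun _ ⟨i, j, h, _, hF⟩ => ⟨i, j, h, hF⟩

lemma chooseSpan_le_chooseSpanLT_succ (d : ℕ) : chooseSpan d ≤ chooseSpanLT (d + 1) :=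
  Submodule.span_mono fun _ ⟨i, j, h, hF⟩ => ⟨i, j, by lia, by lia, hF⟩

lemma sumFst_mem {d : ℕ} {F : ℕ → ℕ → ℚ} (hF : F ∈ chooseSpanLT d) :
    sumFst F ∈ chooseSpanLT (d + 1) := by
  have : chooseSpanLT d ≤ (chooseSpanLT (d + 1)).comap sumFst := by
    refine Submodule.span_le.2 ?_
    rintro _ ⟨i, j, h, h', rfl⟩
    simp only [SetLike.mem_coe, Submodule.mem_comap, sumFst_chooseMul]
    exact Submodule.subset_span ⟨i + 1, j, by lia, by lia, rfl⟩
  exact this hF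

lemma sumSnd_mem {d : ℕ} {F : ℕ → ℕ → ℚ} (hF : F ∈ chooseSpan d) :
    sumSnd F ∈ chooseSpanLT (d + 1) := by
  have : chooseSpan d ≤ (chooseSpanLT (d + 1)).comap sumSnd := by
    refine Submodule.span_le.2 ?_
    rintro _ ⟨i, j, h, rfl⟩
    simp only [SetLike.mem_coe, Submodule.mem_comap, sumSnd_chooseMul]
    exact Submodule.subset_span ⟨i, j + 1, by lia, by lia, rfl⟩
  exact this hF

lemma chooseMul_mem_chooseSpan (d : ℕ) : chooseMul d 0 ∈ chooseSpan d :=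
  Submodule.subset_span ⟨d, 0, by simp, rfl⟩

/-- The binomial coefficient `X_k choose i` as a polynomial. -/
def choosePoly (k : Fin 2) (i : ℕ) : MvPolynomial (Fin 2) ℚ :=
  MvPolynomial.C ((i.factorial : ℚ)⁻¹) *
    ∏ l ∈ range i, (MvPolynomial.X k - MvPolynomial.C (l : ℚ))

lemma totalDegree_choosePoly_le (k : Fin 2) (i : ℕ) : (choosePoly k i).totalDegree ≤ i := by
  refine (MvPolynomial.totalDegree_mul _ _).trans ?_
  rw [MvPolynomial.totalDegree_C, zero_add]
  refine (MvPolynomial.totalDegree_finsetProd _ _).trans ?_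
  refine (sum_le_card_nsmul _ _ 1 fun l _ => ?_).trans (by simp)
  refine (MvPolynomial.totalDegree_sub _ _).trans ?_
  rw [MvPolynomial.totalDegree_X, MvPolynomial.totalDegree_C]
  simp

lemma eval_choosePoly (k : Fin 2) (i : ℕ) (v : Fin 2 → ℚ) (n : ℕ) (hv : v k = n) :
    MvPolynomial.eval v (choosePoly k i) = n.choose i := by
  have h : ∏ l ∈ range i, ((n : ℚ) - l) = n.descFactorial i := by
    rw [← descPochhammer_eval_eq_descFactorial, descPochhammer_eval_eq_prod_range]
  simp only [choosePoly, map_mul, MvPolynomial.eval_C, map_prod, map_sub, MvPolynomial.eval_X, hv, h]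
  rw [Nat.descFactorial_eq_factorial_mul_choose]
  push_cast
  rw [inv_mul_cancel_left₀]
  exact_mod_cast i.factorial_ne_zero

/-- Setting the second variable to zero. -/
def setSndZero : MvPolynomial (Fin 2) ℚ →ₐ[ℚ] Polynomial ℚ :=
  MvPolynomial.aeval ![Polynomial.X, 0]

lemma natDegree_setSndZero_le (p : MvPolynomial (Fin 2) ℚ) :
    (setSndZero p).natDegree ≤ p.totalDegree := by
  simpa [setSndZero] using MvPolynomial.aeval_natDegree_le (n := 1) p le_rfl ![Polynomial.X, 0]
    (by intro i; fin_cases i <;> simp)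

lemma degree_setSndZero_choosePoly_zero (i : ℕ) :
    (setSndZero (choosePoly 0 i)).degree = i := by
  have h : setSndZero (choosePoly 0 i) = Polynomial.C ((i.factorial : ℚ)⁻¹) *
      ∏ l ∈ range i, (Polynomial.X - Polynomial.C (l : ℚ)) := by
    simp [setSndZero, choosePoly, map_prod, Polynomial.C_eq_algebraMap]
  rw [h, Polynomial.degree_C_mul (by positivity), Polynomial.degree_prod]
  simp only [Polynomial.degree_X_sub_C]
  simp

lemma degree_setSndZero_choosePoly_one_le (j : ℕ) :
    (setSndZero (choosePoly 1 j)).degree ≤ 0 := by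
  have h : setSndZero (choosePoly 1 j) = Polynomial.C ((j.factorial : ℚ)⁻¹ *
      ∏ l ∈ range j, (0 - (l : ℚ))) := by
    simp [setSndZero, choosePoly, map_prod, Polynomial.algebraMap_eq]
  rw [h]
  exact Polynomial.degree_C_le

lemma exists_poly_of_mem_chooseSpanLT {d : ℕ} {F : ℕ → ℕ → ℚ} (hF : F ∈ chooseSpanLT d) :
    ∃ q : MvPolynomial (Fin 2) ℚ, q.totalDegree ≤ d ∧ (setSndZero q).degree < d ∧
      ∀ t u : ℕ, F t u = MvPolynomial.eval ![(t : ℚ), (u : ℚ)] q := by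
  refine Submodule.span_induction ?_ ?_ ?_ ?_ hF
  · rintro _ ⟨i, j, h, h', rfl⟩
    refine ⟨choosePoly 0 i * choosePoly 1 j, ?_, ?_, ?_⟩
    · exact (MvPolynomial.totalDegree_mul _ _).trans ((add_le_add (totalDegree_choosePoly_le 0 i)
        (totalDegree_choosePoly_le 1 j)).trans h)
    · rw [map_mul, Polynomial.degree_mul, degree_setSndZero_choosePoly_zero]
      refine lt_of_le_of_lt (add_le_add le_rfl (degree_setSndZero_choosePoly_one_le j)) ?_
      rw [add_zero]
      exact_mod_cast h'
    · intro t u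
      rw [map_mul, eval_choosePoly 0 i _ t (by simp), eval_choosePoly 1 j _ u (by simp)]
      rfl
  · exact ⟨0, by simp, by simp, by simp⟩
  · rintro F G _ _ ⟨p, hp, hp', hpe⟩ ⟨q, hq, hq', hqe⟩
    refine ⟨p + q, (MvPolynomial.totalDegree_add p q).trans (max_le hp hq), ?_, ?_⟩
    · rw [map_add]
      exact (Polynomial.degree_add_le _ _).trans_lt (max_lt hp' hq')
    · intro t u
      simp [hpe, hqe]
  · rintro a F _ ⟨p, hp, hp', hpe⟩
    refine ⟨a • p, (MvPolynomial.totalDegree_smul_le a p).trans hp, ?_, ?_⟩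
    · rw [map_smul]
      exact (Polynomial.degree_smul_le a _).trans_lt hp'
    · intro t u
      simp [hpe]

lemma exists_poly_of_sub_mem_chooseSpanLT {d : ℕ} {F : ℕ → ℕ → ℚ}
    (hF : F - chooseMul d 0 ∈ chooseSpanLT d) :
    ∃ q : MvPolynomial (Fin 2) ℚ, q.totalDegree = d ∧
      ∀ t u : ℕ, F t u = MvPolynomial.eval ![(t : ℚ), (u : ℚ)] q := by
  obtain ⟨p, hp, hp', hpe⟩ := exists_poly_of_mem_chooseSpanLT hF
  refine ⟨p + choosePoly 0 d, le_antisymm ?_ ?_, fun t u => ?_⟩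
  · exact (MvPolynomial.totalDegree_add _ _).trans (max_le hp (totalDegree_choosePoly_le 0 d))
  · have h : (setSndZero (p + choosePoly 0 d)).degree = d := by
      rw [map_add, Polynomial.degree_add_eq_right_of_degree_lt] <;>
        rw [degree_setSndZero_choosePoly_zero]
      exact hp'
    exact (Polynomial.natDegree_eq_of_degree_eq_some h).ge.trans (natDegree_setSndZero_le _)
  · rw [map_add, ← hpe, eval_choosePoly 0 d _ t (by simp)]
    simp [chooseMul]

/-- Submodularity of an integer-valued set function. -/
def IsSubmod (f : Finset α → ℤ) : Prop :=
  ∀ S T, f (S ∪ T) + f (S ∩ T) ≤ f S + f T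

/-- The integer points supported on `E` of the base polytope of `f` on the ground set `E`,
enlarged by `u` copies of the simplex and `t` copies of its negative. -/
def latticePoints (f : Finset α → ℤ) (E : Finset α) (t u : ℕ) : Set (α → ℤ) :=
  {x | (∀ i ∉ E, x i = 0) ∧ ∑ i ∈ E, x i = f E + u - t ∧ ∀ S ⊆ E, ∑ i ∈ S, x i ≤ f S + u}

/-- The integer points supported on `E` that extend to a point of `latticePoints f (insert e E) t u`
with coordinate `c` at `e`. -/
def latticeSlice (f : Finset α → ℤ) (e : α) (E : Finset α) (t u : ℕ) (c : ℤ) : Set (α → ℤ) :=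
  {y | (∀ i ∉ E, y i = 0) ∧ ∑ i ∈ E, y i = f (insert e E) + u - t - c ∧
    ∀ S ⊆ E, ∑ i ∈ S, y i ≤ min (f S) (f (insert e S) - c) + u}

/-- The number of points of `latticePoints`, as a function of `t` and `u`. -/
def latticePointCount (f : Finset α → ℤ) (E : Finset α) : ℕ → ℕ → ℚ :=
  fun t u => ((latticePoints f E t u).ncard : ℚ)

lemma latticePoints_finite (f : Finset α → ℤ) (E : Finset α) (t u : ℕ) :
    (latticePoints f E t u).Finite := by
  refine (Set.finite_Icc (fun i => if i ∈ E then f E - t - f (E.erase i) else 0)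
    (fun i => if i ∈ E then f {i} + u else 0)).subset ?_
  rintro x ⟨h0, hs, hle⟩
  constructor
  · intro i
    by_cases hi : i ∈ E
    · have h1 := hle (E.erase i) (erase_subset _ _)
      have h2 := add_sum_erase E x hi
      simp only [hi, if_true]
      linarith
    · simp [hi, h0 i hi]
  · intro i
    by_cases hi : i ∈ E
    · have h1 := hle {i} (by simpa using hi)
      simpa [hi] using h1
    · simp [hi, h0 i hi]

lemma sum_update_of_subset {e : α} {E S : Finset α} (he : e ∉ E) (hS : S ⊆ E) (x : α → ℤ) (c : ℤ) :
    ∑ i ∈ S, Function.update x e c i = ∑ i ∈ S, x i :=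
  sum_congr rfl fun i hi => Function.update_of_ne (by rintro rfl; exact he (hS hi)) _ _

lemma update_mem_latticeSlice {f : Finset α → ℤ} {e : α} {E : Finset α} (he : e ∉ E) {t u : ℕ}
    {x : α → ℤ} (hx : x ∈ latticePoints f (insert e E) t u) :
    Function.update x e 0 ∈ latticeSlice f e E t u (x e) := by
  obtain ⟨h0, hs, hle⟩ := hx
  refine ⟨fun i hi => ?_, ?_, fun S hS => ?_⟩
  · by_cases h : i = e
    · simp [h]
    · rw [Function.update_of_ne h]
      exact h0 i (by simp [h, hi])
  · rw [sum_update_of_subset he subset_rfl]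
    rw [sum_insert he] at hs
    linarith
  · rw [sum_update_of_subset he hS]
    have h1 := hle S (hS.trans (subset_insert _ _))
    have h2 := hle (insert e S) (insert_subset_insert _ hS)
    rw [sum_insert (fun h => he (hS h))] at h2
    rcases min_cases (f S) (f (insert e S) - x e) with h | h <;> linarith

lemma update_mem_latticePoints {f : Finset α → ℤ} {e : α} {E : Finset α} (he : e ∉ E) {t u : ℕ}
    {c : ℤ} {y : α → ℤ} (hy : y ∈ latticeSlice f e E t u c) :
    Function.update y e c ∈ latticePoints f (insert e E) t u := by
  obtain ⟨h0, hs, hle⟩ := hy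
  refine ⟨fun i hi => ?_, ?_, fun S hS => ?_⟩
  · simp only [mem_insert, not_or] at hi
    rw [Function.update_of_ne hi.1, h0 i hi.2]
  · rw [sum_insert he, sum_update_of_subset he subset_rfl, Function.update_self]
    linarith
  · by_cases h : e ∈ S
    · have hS' : S.erase e ⊆ E := subset_insert_iff.1 hS
      have h1 := hle _ hS'
      rw [insert_erase h] at h1
      rw [← add_sum_erase S _ h, sum_update_of_subset he hS', Function.update_self]
      have h2 := min_le_right (f (S.erase e)) (f S - c)
      linarith
    · have hS' : S ⊆ E := (subset_insert_iff_of_notMem h).1 hS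
      have h1 := hle _ hS'
      rw [sum_update_of_subset he hS']
      have h2 := min_le_left (f S) (f (insert e S) - c)
      linarith

lemma ncard_fiber_eq (f : Finset α → ℤ) {e : α} {E : Finset α} (he : e ∉ E) (t u : ℕ) (c : ℤ) :
    {x ∈ latticePoints f (insert e E) t u | x e = c}.ncard = (latticeSlice f e E t u c).ncard := by
  refine Set.ncard_congr (fun x _ => Function.update x e 0) ?_ ?_ ?_
  · rintro x ⟨hx, rfl⟩
    exact update_mem_latticeSlice he hx
  · rintro x y ⟨-, hx⟩ ⟨-, hy⟩ h
    ext i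
    by_cases hi : i = e
    · rw [hi, hx, hy]
    · simpa [hi] using congrFun h i
  · intro y hy
    refine ⟨Function.update y e c, ⟨update_mem_latticePoints he hy, by simp⟩, ?_⟩
    rw [Function.update_idem, ← hy.1 e he, Function.update_eq_self]

lemma ncard_latticePoints_insert (f : Finset α → ℤ) {e : α} {E : Finset α} (he : e ∉ E) (t u : ℕ) :
    (latticePoints f (insert e E) t u).ncard =
      ∑ c ∈ Icc (f (insert e E) - f E - t) (f {e} + u), (latticeSlice f e E t u c).ncard := by
  classical
  have hfin := latticePoints_finite f (insert e E) t u
  rw [Set.ncard_eq_toFinset_card _ hfin, card_eq_sum_card_fiberwise (f := fun x => x e)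
    (t := Icc (f (insert e E) - f E - t) (f {e} + u))]
  · refine sum_congr rfl fun c _ => ?_
    rw [← ncard_fiber_eq f he, ← Set.ncard_coe_finset]
    congr 1
    ext x
    simp
  · intro x hx
    simp only [Set.Finite.coe_toFinset] at hx
    obtain ⟨h0, hs, hle⟩ := hx
    have h1 := hle {e} (by simp)
    have h2 := hle E (subset_insert _ _)
    rw [sum_insert he] at hs
    rw [sum_singleton] at h1
    simp only [coe_Icc, Set.mem_Icc]
    constructor <;> linarith

lemma IsSubmod.insert_sub_le {f : Finset α → ℤ} (hf : IsSubmod f) {e : α} {E S : Finset α}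
    (he : e ∉ E) (hS : S ⊆ E) : f (insert e E) - f E ≤ f (insert e S) - f S := by
  have h := hf (insert e S) E
  rw [insert_union, union_eq_right.2 hS, insert_inter_of_notMem he, inter_eq_left.2 hS] at h
  linarith

lemma latticeSlice_low {f : Finset α → ℤ} (hf : IsSubmod f) {e : α} {E : Finset α} (he : e ∉ E)
    {t : ℕ} (u : ℕ) {s : ℕ} (hs : s < t) :
    latticeSlice f e E t u (f (insert e E) - f E - t + s) = latticePoints f E s u := by
  ext y
  refine and_congr_right fun _ => and_congr ?_ (forall₂_congr fun S hS => ?_)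
  · constructor <;> intro h <;> linarith
  · have := hf.insert_sub_le he hS
    rw [min_eq_left (by lia)]

lemma latticeSlice_high {f : Finset α → ℤ} (hf : IsSubmod f) (h0 : f ∅ = 0) {e : α} {E : Finset α}
    (he : e ∉ E) (t : ℕ) {u s : ℕ} (hs : s < u) :
    latticeSlice f e E t u (f {e} + u - s) =
      latticePoints (fun S => f (insert e S) - f {e}) E t s := by
  ext y
  refine and_congr_right fun _ => and_congr ?_ (forall₂_congr fun S hS => ?_)
  · constructor <;> intro h <;> linarith
  · have := hf.insert_sub_le (fun h => he (hS h)) (empty_subset S)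
    rw [insert_empty] at this
    rw [min_eq_right (by lia)]
    constructor <;> intro h <;> linarith

lemma latticeSlice_mid (f : Finset α → ℤ) {e : α} {E : Finset α} (t u : ℕ) {c : ℤ}
    (hc : f (insert e E) - f E ≤ c) :
    latticeSlice f e E t u c =
      latticePoints (fun S => min (f S) (f (insert e S) - c)) E t u := by
  ext y
  refine and_congr_right fun _ => and_congr ?_ Iff.rfl
  simp only
  rw [min_eq_right (by lia)]
  constructor <;> intro h <;> linarith

lemma sum_Icc_split (g : ℤ → ℚ) {k m : ℤ} (hkm : k ≤ m) (t u : ℕ) :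
    ∑ c ∈ Icc (k - t) (m + u), g c = ∑ s ∈ range t, g (k - t + s) + ∑ c ∈ Icc k m, g c +
      ∑ s ∈ range u, g (m + u - s) := by
  induction u with
  | zero =>
    induction t with
    | zero => simp
    | succ t ih =>
      have h : Icc (k - (t + 1 : ℕ)) (m + (0 : ℕ)) =
          insert (k - (t + 1 : ℕ)) (Icc (k - t) (m + (0 : ℕ))) := by
        ext c
        simp only [mem_Icc, mem_insert]
        lia
      rw [h, sum_insert (by simp; lia), ih, sum_range_succ']
      have h' : ∀ s : ℕ, k - (t + 1 : ℕ) + (s + 1 : ℕ) = k - t + s := fun s => by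
        push_cast
        ring
      simp only [h']
      simp
      ring
  | succ u ih =>
    have h : Icc (k - t) (m + (u + 1 : ℕ)) = insert (m + (u + 1 : ℕ)) (Icc (k - t) (m + u)) := by
      ext c
      simp only [mem_Icc, mem_insert]
      lia
    rw [h, sum_insert (by simp), ih, sum_range_succ' _ u]
    have h' : ∀ s : ℕ, m + (u + 1 : ℕ) - (s + 1 : ℕ) = m + u - s := fun s => by
      push_cast
      ring
    simp only [h']
    simp
    ring

lemma latticePointCount_insert {f : Finset α → ℤ} (hf : IsSubmod f) (h0 : f ∅ = 0) {e : α}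
    {E : Finset α} (he : e ∉ E) :
    latticePointCount f (insert e E) = sumFst (latticePointCount f E) +
      ∑ c ∈ Icc (f (insert e E) - f E) (f {e}),
        latticePointCount (fun S => min (f S) (f (insert e S) - c)) E +
      sumSnd (latticePointCount (fun S => f (insert e S) - f {e}) E) := by
  have hk : f (insert e E) - f E ≤ f {e} := by
    have := hf.insert_sub_le he (empty_subset E)
    rwa [insert_empty, h0, sub_zero] at this
  ext t u
  simp only [latticePointCount, Pi.add_apply, Finset.sum_apply, sumFst, sumSnd, LinearMap.coe_mk,
    AddHom.coe_mk]
  rw [ncard_latticePoints_insert f he, Nat.cast_sum, sum_Icc_split _ hk]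
  congr 1
  · congr 1
    · exact sum_congr rfl fun s hs => by rw [latticeSlice_low hf he u (mem_range.1 hs)]
    · exact sum_congr rfl fun c hc => by rw [latticeSlice_mid f t u (mem_Icc.1 hc).1]
  · exact sum_congr rfl fun s hs => by rw [latticeSlice_high hf h0 he t (mem_range.1 hs)]

lemma IsSubmod.contract {f : Finset α → ℤ} (hf : IsSubmod f) (e : α) :
    IsSubmod fun S => f (insert e S) - f {e} := by
  intro S T
  have h := hf (insert e S) (insert e T)
  rw [← insert_union_distrib, ← insert_inter_distrib] at h
  simp only
  linarith

lemma IsSubmod.min_insert {f : Finset α → ℤ} (hf : IsSubmod f) (e : α) (c : ℤ) :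
    IsSubmod fun S => min (f S) (f (insert e S) - c) := by
  have key : ∀ S T : Finset α, min (f (S ∪ T)) (f (insert e (S ∪ T)) - c) +
      min (f (S ∩ T)) (f (insert e (S ∩ T)) - c) ≤ f S + (f (insert e T) - c) := by
    intro S T
    have h := hf S (insert e T)
    rw [union_insert] at h
    by_cases he : e ∈ S
    · rw [inter_insert_of_mem he, insert_eq_of_mem (mem_union_left T he)] at h
      have h1 := min_le_left (f (S ∪ T)) (f (insert e (S ∪ T)) - c)
      have h2 := min_le_right (f (S ∩ T)) (f (insert e (S ∩ T)) - c)
      linarith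
    · rw [inter_insert_of_notMem he] at h
      have h1 := min_le_right (f (S ∪ T)) (f (insert e (S ∪ T)) - c)
      have h2 := min_le_left (f (S ∩ T)) (f (insert e (S ∩ T)) - c)
      linarith
  intro S T
  have h1 := hf S T
  have h2 := hf (insert e S) (insert e T)
  rw [← insert_union_distrib, ← insert_inter_distrib] at h2
  have h3 := key S T
  have h4 := key T S
  rw [union_comm, inter_comm] at h4
  simp only
  have h5 := min_le_left (f (S ∪ T)) (f (insert e (S ∪ T)) - c)
  have h6 := min_le_right (f (S ∪ T)) (f (insert e (S ∪ T)) - c)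
  have h7 := min_le_left (f (S ∩ T)) (f (insert e (S ∩ T)) - c)
  have h8 := min_le_right (f (S ∩ T)) (f (insert e (S ∩ T)) - c)
  rcases min_choice (f S) (f (insert e S) - c) with h | h <;>
    rcases min_choice (f T) (f (insert e T) - c) with h' | h' <;> rw [h, h'] <;> linarith

lemma latticePointCount_singleton {f : Finset α → ℤ} (h0 : f ∅ = 0) (e : α) :
    latticePointCount f {e} = chooseMul 0 0 := by
  ext t u
  have h : latticePoints f {e} t u = {Pi.single e (f {e} + u - t)} := by
    ext x
    simp only [latticePoints, mem_singleton, sum_singleton, Set.mem_ofPred_eq,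
      Set.mem_singleton_iff]
    constructor
    · rintro ⟨h1, h2, -⟩
      ext i
      by_cases hi : i = e
      · subst hi
        simp [h2]
      · simp [hi, h1 i hi]
    · rintro rfl
      refine ⟨fun i hi => by simp [hi], by simp, fun S hS => ?_⟩
      rcases subset_singleton_iff.1 hS with rfl | rfl
      · simp [h0]
      · simp
  simp [latticePointCount, h, chooseMul]

theorem latticePointCount_sub_mem {E : Finset α} (hE : E.Nonempty) :
    ∀ f : Finset α → ℤ, IsSubmod f → f ∅ = 0 →
      latticePointCount f E - chooseMul (E.card - 1) 0 ∈ chooseSpanLT (E.card - 1) := by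
  induction hE using Finset.Nonempty.cons_induction with
  | singleton e =>
    intro f _ h0
    simp [latticePointCount_singleton h0]
  | cons e E he hE ih =>
    intro f hf h0
    rw [card_cons, cons_eq_insert, Nat.add_sub_cancel]
    obtain ⟨d, hd⟩ : ∃ d, E.card = d + 1 := ⟨E.card - 1, by have := hE.card_pos; lia⟩
    rw [hd]
    simp only [hd, Nat.add_sub_cancel] at ih
    have ih' : ∀ f : Finset α → ℤ, IsSubmod f → f ∅ = 0 → latticePointCount f E ∈ chooseSpan d := by
      intro f hf h0
      have := add_mem (chooseSpanLT_le_chooseSpan d (ih f hf h0)) (chooseMul_mem_chooseSpan d)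
      rwa [sub_add_cancel] at this
    rw [latticePointCount_insert hf h0 he, ← sumFst_chooseMul, add_assoc, add_sub_right_comm,
      ← map_sub]
    refine add_mem (sumFst_mem (ih f hf h0)) (add_mem (sum_mem fun c hc => ?_) (sumSnd_mem ?_))
    · refine chooseSpan_le_chooseSpanLT_succ d (ih' _ (hf.min_insert e c) ?_)
      have := (mem_Icc.1 hc).2
      rw [insert_empty, h0, min_eq_left (by linarith)]
    · exact ih' _ (hf.contract e) (by simp)

lemma sum_single_one (e : α) (S : Finset α) :
    ∑ i ∈ S, (Pi.single e (1 : ℤ) : α → ℤ) i = if e ∈ S then 1 else 0 := by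
  simp [Pi.single_apply]

lemma IsSubmod.exists_sub {f : Finset α → ℤ} [Nonempty α] (hf : IsSubmod f) (h0 : f ∅ = 0) (u : ℕ) :
    ∀ x : α → ℤ, (∀ S, ∑ i ∈ S, x i ≤ f S + u) →
      ∃ a : α → ℤ, (∀ i, 0 ≤ a i) ∧ ∑ i, a i = u ∧ ∀ S, ∑ i ∈ S, (x - a) i ≤ f S := by
  induction u with
  | zero => exact fun x hx => ⟨0, by simp, by simp, by simpa using hx⟩
  | succ u ih =>
    intro x hx
    obtain ⟨e, he⟩ : ∃ e, ∀ S, ∑ i ∈ S, (x - Pi.single e 1 : α → ℤ) i ≤ f S + u := by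
      by_contra! hcon
      have tight : ∀ e, ∃ S, e ∉ S ∧ f S + u + 1 ≤ ∑ i ∈ S, x i := by
        intro e
        obtain ⟨S, hS⟩ := hcon e
        simp only [Pi.sub_apply, sum_sub_distrib, sum_single_one] at hS
        have hxS := hx S
        push_cast at hxS
        refine ⟨S, fun heS => ?_, ?_⟩
        · rw [if_pos heS] at hS
          linarith
        · split_ifs at hS <;> linarith
      have avoid : ∀ A : Finset α, ∃ S, (∀ e ∈ A, e ∉ S) ∧ f S + u + 1 ≤ ∑ i ∈ S, x i := by
        intro A
        induction A using Finset.induction_on with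
        | empty =>
          obtain ⟨S, -, hS⟩ := tight (Classical.arbitrary α)
          exact ⟨S, by simp, hS⟩
        | insert e A _ ihA =>
          obtain ⟨S, hSA, hS⟩ := ihA
          obtain ⟨T, heT, hT⟩ := tight e
          refine ⟨S ∩ T, ?_, ?_⟩
          · intro i hi
            rcases mem_insert.1 hi with rfl | hi
            · exact fun h => heT (mem_inter.1 h).2
            · exact fun h => hSA i hi (mem_inter.1 h).1
          · have h1 := sum_union_inter (s₁ := S) (s₂ := T) (f := x)
            have h2 := hx (S ∪ T)
            have h3 := hf S T
            push_cast at h2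
            linarith
      obtain ⟨S, hS, hS'⟩ := avoid univ
      have : S = ∅ := eq_empty_of_forall_notMem fun i => hS i (mem_univ i)
      rw [this, h0, sum_empty] at hS'
      lia
    obtain ⟨a, ha0, has, hale⟩ := ih _ he
    refine ⟨a + Pi.single e 1, fun i => ?_, ?_, fun S => ?_⟩
    · have h1 := ha0 i
      have h2 : (0 : α → ℤ) ≤ Pi.single e 1 := by simp
      exact add_nonneg h1 (h2 i)
    · simp [sum_add_distrib, has]
    · rw [add_comm, ← sub_sub]
      exact hale S

lemma IsSubmod.exists_add {f : Finset α → ℤ} (hf : IsSubmod f) (h0 : f ∅ = 0) (t : ℕ) :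
    ∀ x : α → ℤ, (∀ S, ∑ i ∈ S, x i ≤ f S) → ∑ i, x i = f univ - t →
      ∃ b : α → ℤ, (∀ i, 0 ≤ b i) ∧ ∑ i, b i = t ∧ ∀ S, ∑ i ∈ S, (x + b) i ≤ f S := by
  induction t with
  | zero => exact fun x hx _ => ⟨0, by simp, by simp, by simpa using hx⟩
  | succ t ih =>
    intro x hx hxs
    obtain ⟨e, he⟩ : ∃ e, ∀ S, ∑ i ∈ S, (x + Pi.single e 1 : α → ℤ) i ≤ f S := by
      by_contra! hcon
      have tight : ∀ e, ∃ S, e ∈ S ∧ f S ≤ ∑ i ∈ S, x i := by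
        intro e
        obtain ⟨S, hS⟩ := hcon e
        simp only [Pi.add_apply, sum_add_distrib, sum_single_one] at hS
        have hxS := hx S
        refine ⟨S, ?_, ?_⟩
        · by_contra heS
          rw [if_neg heS] at hS
          linarith
        · split_ifs at hS <;> linarith
      have cover : ∀ A : Finset α, ∃ S, A ⊆ S ∧ f S ≤ ∑ i ∈ S, x i := by
        intro A
        induction A using Finset.induction_on with
        | empty => exact ⟨∅, subset_rfl, by simp [h0]⟩
        | insert e A _ ihA =>
          obtain ⟨S, hSA, hS⟩ := ihA
          obtain ⟨T, heT, hT⟩ := tight e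
          refine ⟨S ∪ T, insert_subset (mem_union_right _ heT)
            (hSA.trans subset_union_left), ?_⟩
          have h1 := sum_union_inter (s₁ := S) (s₂ := T) (f := x)
          have h2 := hx (S ∩ T)
          have h3 := hf S T
          linarith
      obtain ⟨S, hS, hS'⟩ := cover univ
      rw [univ_subset_iff.1 hS, hxs] at hS'
      push_cast at hS'
      linarith
    obtain ⟨b, hb0, hbs, hble⟩ := ih _ he (by
      simp only [Pi.add_apply, sum_add_distrib, hxs, sum_single_one, mem_univ, if_true]
      push_cast
      ring)
    refine ⟨Pi.single e 1 + b, fun i => ?_, ?_, fun S => ?_⟩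
    · have h1 := hb0 i
      have h2 : (0 : α → ℤ) ≤ Pi.single e 1 := by simp
      exact add_nonneg (h2 i) h1
    · simp [sum_add_distrib, hbs, add_comm]
    · rw [← add_assoc]
      exact hble S

lemma stdSimplexSet_eq : stdSimplexSet α = stdSimplex ℝ α := by
  rw [← convexHull_rangle_single_eq_stdSimplex]
  rw [stdSimplexSet]
  congr 1
  ext x
  simp [eq_comm]

lemma cast_mem_smul_stdSimplexSet [Nonempty α] {n : ℕ} {a : α → ℤ} (h0 : ∀ i, 0 ≤ a i)
    (hs : ∑ i, a i = n) : (fun i => (a i : ℝ)) ∈ (n : ℝ) • stdSimplexSet α := by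
  rw [stdSimplexSet_eq, Set.mem_smul_set]
  rcases Nat.eq_zero_or_pos n with rfl | hn
  · refine ⟨Pi.single (Classical.arbitrary α) 1, single_mem_stdSimplex _ _, ?_⟩
    rw [Nat.cast_zero, sum_eq_zero_iff_of_nonneg fun i _ => h0 i] at hs
    ext i
    simp [hs i (mem_univ i)]
  · have hn' : (n : ℝ) ≠ 0 := by positivity
    refine ⟨fun i => a i / n, ⟨fun i => div_nonneg (by exact_mod_cast h0 i) (by positivity), ?_⟩, ?_⟩
    · rw [← sum_div, div_eq_one_iff_eq hn']
      exact_mod_cast hs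
    · ext i
      simp [mul_div_cancel₀ _ hn']

lemma stdSimplexSet_sum_bounds {a : α → ℝ} (ha : a ∈ stdSimplexSet α) (S : Finset α) :
    0 ≤ ∑ i ∈ S, a i ∧ ∑ i ∈ S, a i ≤ 1 := by
  rw [stdSimplexSet_eq] at ha
  exact ⟨sum_nonneg fun i _ => ha.1 i,
    ha.2 ▸ sum_le_sum_of_subset_of_nonneg (subset_univ S) fun i _ _ => ha.1 i⟩

lemma stdSimplexSet_sum_eq_one {a : α → ℝ} (ha : a ∈ stdSimplexSet α) : ∑ i, a i = 1 := by
  rw [stdSimplexSet_eq] at ha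
  exact ha.2

lemma PolyMatroid.isSubmod (M : PolyMatroid α) : IsSubmod fun S => (M.rk S : ℤ) :=
  fun S T => by
    dsimp only
    exact_mod_cast M.rk_submod S T

lemma PolyMatroid.setOf_cast_mem_eq_latticePoints [Nonempty α] (M : PolyMatroid α) (t u : ℕ) :
    {q : α → ℤ | (fun i => (q i : ℝ)) ∈
      M.polytope + (u : ℝ) • stdSimplexSet α + (t : ℝ) • (-stdSimplexSet α)} =
      latticePoints (fun S => (M.rk S : ℤ)) univ t u := by
  have hr0 : (M.rk ∅ : ℤ) = 0 := by simp [M.rk_empty]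
  ext q
  simp only [Set.mem_ofPred_eq, latticePoints]
  constructor
  · rintro ⟨_, ⟨y, hy, _, ⟨a, ha, rfl⟩, rfl⟩, _, ⟨b, hb, rfl⟩, h⟩
    rw [Set.mem_neg] at hb
    have hq : ∀ S : Finset α, ((∑ i ∈ S, q i : ℤ) : ℝ) =
        ∑ i ∈ S, y i + u * ∑ i ∈ S, a i - t * ∑ i ∈ S, (-b) i := by
      intro S
      rw [Int.cast_sum, mul_sum, mul_sum, ← sum_add_distrib, ← sum_sub_distrib]
      refine sum_congr rfl fun i _ => ?_
      have := congrFun h i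
      simp only [Pi.add_apply, Pi.smul_apply, smul_eq_mul] at this
      rw [← this, Pi.neg_apply]
      ring
    refine ⟨by simp, ?_, fun S _ => ?_⟩
    · have := hq univ
      rw [stdSimplexSet_sum_eq_one ha, stdSimplexSet_sum_eq_one hb, hy.1] at this
      rw [← Int.cast_inj (α := ℝ), this]
      push_cast
      ring
    · rw [← Int.cast_le (R := ℝ), hq S]
      have h1 := mul_le_of_le_one_right (Nat.cast_nonneg (α := ℝ) u)
        (stdSimplexSet_sum_bounds ha S).2
      have h2 := mul_nonneg (Nat.cast_nonneg (α := ℝ) t) (stdSimplexSet_sum_bounds hb S).1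
      have h3 := hy.2 S
      push_cast
      linarith
  · rintro ⟨-, hs, hle⟩
    obtain ⟨a, ha0, has, hale⟩ := M.isSubmod.exists_sub hr0 u q fun S => hle S (subset_univ S)
    obtain ⟨b, hb0, hbs, hble⟩ := M.isSubmod.exists_add hr0 t (q - a) hale (by
      simp only [Pi.sub_apply, sum_sub_distrib, hs, has]
      ring)
    refine ⟨_, ⟨fun i => ((q - a + b) i : ℝ), ⟨?_, fun S => ?_⟩, _,
      cast_mem_smul_stdSimplexSet ha0 has, rfl⟩, -fun i => (b i : ℝ), ?_, ?_⟩
    · have : ∑ i, (q - a + b) i = M.rk univ := by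
        simp only [Pi.add_apply, Pi.sub_apply, sum_add_distrib, sum_sub_distrib, hs, has, hbs]
        ring
      dsimp only
      exact_mod_cast this
    · dsimp only
      exact_mod_cast hble S
    · rw [Set.smul_set_neg, Set.neg_mem_neg]
      exact cast_mem_smul_stdSimplexSet hb0 hbs
    · ext i
      simp only [Pi.add_apply, Pi.sub_apply, Pi.neg_apply]
      push_cast
      ring

/-- For a polymatroid `M` on a nonempty finite set `E`, there is a
bivariate polynomial `q` with rational coefficients of total degree `|E| − 1` such that
`q(t,u)` is the number of lattice points in `P(M) + uΔ + t∇` for all `t, u ∈ ℕ`. -/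
theorem stmt_5 {α : Type*} [Fintype α] [DecidableEq α] [Nonempty α]
    (M : PolyMatroid α) :
    ∃ q : MvPolynomial (Fin 2) ℚ,
      q.totalDegree = Fintype.card α - 1 ∧
      ∀ t u : ℕ,
        (Qcount M.polytope t u : ℚ) = MvPolynomial.eval ![(t : ℚ), (u : ℚ)] q := by
  have h := latticePointCount_sub_mem (univ_nonempty (α := α)) _ M.isSubmod (by simp [M.rk_empty])
  obtain ⟨q, hq, hqe⟩ := exists_poly_of_sub_mem_chooseSpanLT h
  refine ⟨q, by rw [hq, card_univ], fun t u => ?_⟩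
  rw [← hqe, latticePointCount, Qcount, latticeCount, M.setOf_cast_mem_eq_latticePoints]

end
end
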